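/- Let Σ be a countable alphabet. There is a Borel measurable map assigning to each quadruple (y, I, J, s), where y ∈ Σ_AP^ℤ, I, J ⊆ ℤ, and s is a real with s̄(I) < s < s̄(J), an injection f = f_{(y,I,J,s)} : I → J, such that the assignment is equivariant in the sense that f_{(Sy, SI, SJ, s)}(i) = f_{(y,I,J,s)}(i+1) − 1 for all i ∈ SI, and such that the image satisfies s̄(f(I)) < s. The same statement holds with the lower density s̲ in place of the upper density s̄ throughout. -/

import Mathlib

open Filter
open scoped Classical

/-- Discrete measurable structure on `Option ℤ` (partial values). -/
instance optionIntMeasurableSpace : MeasurableSpace (Option ℤ) := ⊤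

/-- The shift on `Λ^ℤ`. -/
def shift {Λ : Type*} (x : ℤ → Λ) : ℤ → Λ := fun i => x (i + 1)

/-- The shift on subsets of `ℤ`: `SI = I − 1 = {i : i + 1 ∈ I}`. -/
def shiftSet (I : Set ℤ) : Set ℤ := {i | i + 1 ∈ I}

/-- A point of `Λ^ℤ` is aperiodic if no shift `S^p`, `p ≥ 1`, fixes it. -/
def Aperiodic {Λ : Type*} (x : ℤ → Λ) : Prop :=
  ∀ p : ℕ, 1 ≤ p → (fun i => x (i + (p : ℤ))) ≠ x

/-- The lower density of `I ⊆ ℤ`: `liminf_N (1/N)·|I ∩ [0,N−1]|`. -/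
noncomputable def lowerDensity (I : Set ℤ) : ℝ :=
  liminf (fun N : ℕ => (∑ i ∈ Finset.range N, if (i : ℤ) ∈ I then (1 : ℝ) else 0) / N) atTop

/-- The upper density of `I ⊆ ℤ`: `limsup_N (1/N)·|I ∩ [0,N−1]|`. -/
noncomputable def upperDensity (I : Set ℤ) : ℝ :=
  limsup (fun N : ℕ => (∑ i ∈ Finset.range N, if (i : ℤ) ∈ I then (1 : ℝ) else 0) / N) atTop

/-- The statement that `F` is a Borel, equivariant choice of partial injections `I → J`
(encoded as maps `ℤ → Option ℤ` with domain of definition `I`) for all data `(y,I,J,s)` with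
`dens I < s < dens J`, with image of density `< s`; here `dens` is a density notion on
subsets of `ℤ`. -/
def IsEquivariantInjectionChoice {Λ : Type*} [MeasurableSpace Λ] (dens : Set ℤ → ℝ)
    (F : (ℤ → Λ) → Set ℤ → Set ℤ → ℝ → (ℤ → Option ℤ)) : Prop :=
  Measurable (fun p : (ℤ → Λ) × Set ℤ × Set ℤ × ℝ => F p.1 p.2.1 p.2.2.1 p.2.2.2) ∧
  ∀ (y : ℤ → Λ) (I J : Set ℤ) (s : ℝ), Aperiodic y → dens I < s → s < dens J →
    -- the domain of definition is exactly `I`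
    (∀ i : ℤ, (F y I J s i).isSome ↔ i ∈ I) ∧
    -- values lie in `J`
    (∀ i ∈ I, ∀ j : ℤ, F y I J s i = some j → j ∈ J) ∧
    -- injectivity
    (∀ i i' j : ℤ, F y I J s i = some j → F y I J s i' = some j → i = i') ∧
    -- equivariance: `f_{(Sy,SI,SJ,s)}(i) = f_{(y,I,J,s)}(i+1) − 1`
    (∀ i : ℤ, F (shift y) (shiftSet I) (shiftSet J) s i =
      Option.map (fun m => m - 1) (F y I J s (i + 1))) ∧
    -- the image has density `< s`
    dens {j : ℤ | ∃ i ∈ I, F y I J s i = some j} < s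

/-! ### Counting and densities -/

/-- The number of elements of `I` in the interval `[a, a + n)`. -/
noncomputable def count (I : Set ℤ) (a : ℤ) (n : ℕ) : ℕ :=
  ∑ k ∈ Finset.range n, if a + (k : ℤ) ∈ I then 1 else 0

lemma count_zero (I : Set ℤ) (a : ℤ) : count I a 0 = 0 := by simp [count]

lemma count_succ (I : Set ℤ) (a : ℤ) (n : ℕ) :
    count I a (n + 1) = count I a n + if a + (n : ℤ) ∈ I then 1 else 0 := by
  unfold count; rw [Finset.sum_range_succ]

lemma count_add (I : Set ℤ) (a : ℤ) (m n : ℕ) :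
    count I a (m + n) = count I a m + count I (a + m) n := by
  unfold count; simp_rw [Finset.sum_range_add, Nat.cast_add, add_assoc]

lemma count_le (I : Set ℤ) (a : ℤ) (n : ℕ) : count I a n ≤ n := by
  induction n with
  | zero => simp [count]
  | succ n ih => rw [count_succ]; split_ifs <;> omega

lemma count_mono {I J : Set ℤ} (h : I ⊆ J) (a : ℤ) (n : ℕ) : count I a n ≤ count J a n :=
  Finset.sum_le_sum fun k _ => by
    by_cases hk : a + (k : ℤ) ∈ I
    · simp [hk, h hk]
    · simp [hk]

lemma count_shiftSet (I : Set ℤ) (a : ℤ) (n : ℕ) :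
    count (shiftSet I) a n = count I (a + 1) n :=
  Finset.sum_congr rfl fun k _ => by rw [add_right_comm]; rfl

/-- The proportion of `I` in `[0, N)`. -/
noncomputable def average (I : Set ℤ) (N : ℕ) : ℝ := count I 0 N / N

lemma average_nonneg (I : Set ℤ) (N : ℕ) : 0 ≤ average I N := by
  unfold average; positivity

lemma average_le_one (I : Set ℤ) (N : ℕ) : average I N ≤ 1 :=
  div_le_one_of_le₀ (by exact_mod_cast count_le I 0 N) (by positivity)

lemma upperDensity_eq (I : Set ℤ) : upperDensity I = limsup (average I) atTop := by
  unfold upperDensity average count; simp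

lemma lowerDensity_eq (I : Set ℤ) : lowerDensity I = liminf (average I) atTop := by
  unfold lowerDensity average count; simp

lemma Measurable.count {α : Type*} [MeasurableSpace α] {f : α → Set ℤ} (hf : Measurable f)
    (a : ℤ) (n : ℕ) : Measurable fun x => count (f x) a n := by
  unfold _root_.count
  refine Finset.measurable_sum _ fun k _ => Measurable.ite ?_ measurable_const measurable_const
  exact (measurable_set_iff.1 hf _).setOf

lemma measurable_average (N : ℕ) : Measurable fun I : Set ℤ => average I N := by
  unfold average
  exact (measurable_from_nat.comp (measurable_id.count 0 N)).div_const _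

/-- The properties shared by the upper and the lower density: Borel measurability, and
compatibility with eventual affine comparisons of the averages. -/
structure IsDensity (dens : Set ℤ → ℝ) : Prop where
  measurable : Measurable dens
  le_affine : ∀ {I J : Set ℤ} {c d : ℝ}, 0 ≤ c →
    (∀ᶠ N in atTop, average I N ≤ c * average J N + d) → dens I ≤ c * dens J + d
  affine_le : ∀ {I J : Set ℤ} {c d : ℝ}, 0 ≤ c →
    (∀ᶠ N in atTop, c * average J N + d ≤ average I N) → c * dens J + d ≤ dens I

section Bounded

variable (I : Set ℤ) (c d : ℝ)

lemma isBoundedUnder_le_affine (hc : 0 ≤ c) :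
    IsBoundedUnder (· ≤ ·) atTop fun N => c * average I N + d :=
  isBoundedUnder_of ⟨c * 1 + d, fun N => by gcongr; exact average_le_one I N⟩

lemma isBoundedUnder_ge_affine (hc : 0 ≤ c) :
    IsBoundedUnder (· ≥ ·) atTop fun N => c * average I N + d :=
  isBoundedUnder_of ⟨c * 0 + d, fun N => by
    change c * 0 + d ≤ c * average I N + d
    gcongr; exact average_nonneg I N⟩

lemma isBoundedUnder_le_average : IsBoundedUnder (· ≤ ·) atTop (average I) :=
  isBoundedUnder_of ⟨1, average_le_one I⟩

lemma isBoundedUnder_ge_average : IsBoundedUnder (· ≥ ·) atTop (average I) :=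
  isBoundedUnder_of ⟨0, average_nonneg I⟩

lemma limsup_affine_average (hc : 0 ≤ c) :
    limsup (fun N => c * average I N + d) atTop = c * limsup (average I) atTop + d := by
  have hmono : Monotone fun x : ℝ => c * x + d := fun x y h => by dsimp only; gcongr
  exact (hmono.map_limsup_of_continuousAt (average I) (by fun_prop) (isBoundedUnder_le_average I)
    (isBoundedUnder_ge_average I).isCoboundedUnder_le).symm

lemma liminf_affine_average (hc : 0 ≤ c) :
    liminf (fun N => c * average I N + d) atTop = c * liminf (average I) atTop + d := by
  have hmono : Monotone fun x : ℝ => c * x + d := fun x y h => by dsimp only; gcongr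
  exact (hmono.map_liminf_of_continuousAt (average I) (by fun_prop)
    (isBoundedUnder_le_average I).isCoboundedUnder_ge (isBoundedUnder_ge_average I)).symm

end Bounded

lemma isDensity_upperDensity : IsDensity upperDensity where
  measurable := by
    rw [funext upperDensity_eq]
    exact Measurable.limsup measurable_average
  le_affine {I J c d} hc h := by
    rw [upperDensity_eq, upperDensity_eq, ← limsup_affine_average J c d hc]
    exact limsup_le_limsup h (isBoundedUnder_ge_average I).isCoboundedUnder_le
      (isBoundedUnder_le_affine J c d hc)
  affine_le {I J c d} hc h := by
    rw [upperDensity_eq, upperDensity_eq, ← limsup_affine_average J c d hc]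
    exact limsup_le_limsup h (isBoundedUnder_ge_affine J c d hc).isCoboundedUnder_le
      (isBoundedUnder_le_average I)

lemma isDensity_lowerDensity : IsDensity lowerDensity where
  measurable := by
    rw [funext lowerDensity_eq]
    exact Measurable.liminf measurable_average
  le_affine {I J c d} hc h := by
    rw [lowerDensity_eq, lowerDensity_eq, ← liminf_affine_average J c d hc]
    exact liminf_le_liminf h (isBoundedUnder_ge_average I)
      (isBoundedUnder_le_affine J c d hc).isCoboundedUnder_ge
  affine_le {I J c d} hc h := by
    rw [lowerDensity_eq, lowerDensity_eq, ← liminf_affine_average J c d hc]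
    exact liminf_le_liminf h (isBoundedUnder_ge_affine J c d hc)
      (isBoundedUnder_le_average I).isCoboundedUnder_ge

namespace IsDensity

variable {dens : Set ℤ → ℝ}

lemma nonneg (hD : IsDensity dens) (I : Set ℤ) : 0 ≤ dens I := by
  have := hD.affine_le (I := I) (J := I) (c := 0) (d := 0) le_rfl
    (Eventually.of_forall fun N => by simpa using average_nonneg I N)
  simpa using this

lemma le_of_count_le (hD : IsDensity dens) {I J : Set ℤ}
    (h : ∀ N, count I 0 N ≤ count J 0 N) : dens I ≤ dens J := by
  have := hD.le_affine (I := I) (J := J) (c := 1) (d := 0) zero_le_one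
    (Eventually.of_forall fun N => by
      have : (count I 0 N : ℝ) ≤ count J 0 N := by exact_mod_cast h N
      simp only [average, one_mul, add_zero]
      gcongr)
  simpa using this

lemma mono (hD : IsDensity dens) {I J : Set ℤ} (h : I ⊆ J) : dens I ≤ dens J :=
  hD.le_of_count_le (count_mono h 0)

lemma exists_count_lt (hD : IsDensity dens) {I J : Set ℤ} (h : dens I < dens J) :
    ∃ N, count I 0 N < count J 0 N := by
  by_contra! hcon
  exact h.not_ge (hD.le_of_count_le hcon)

/-- A linear estimate of the counts, up to a constant, gives an estimate of the densities. -/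
lemma abs_sub_le (hD : IsDensity dens) {I J : Set ℤ} {c δ δ' K : ℝ} (hc : 0 ≤ c) (hδ : δ < δ')
    (h : ∀ᶠ N : ℕ in atTop, |(count I 0 N : ℝ) - c * count J 0 N| ≤ δ * N + K) :
    |dens I - c * dens J| ≤ δ' := by
  have key : ∀ᶠ N : ℕ in atTop, |average I N - c * average J N| ≤ δ' := by
    have hK : ∀ᶠ N : ℕ in atTop, K ≤ (δ' - δ) * N :=
      (tendsto_natCast_atTop_atTop.const_mul_atTop (sub_pos.2 hδ)).eventually_ge_atTop K
    filter_upwards [h, hK, eventually_gt_atTop 0] with N h1 h2 h3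
    have hN : (0 : ℝ) < N := by exact_mod_cast h3
    have : average I N - c * average J N = ((count I 0 N : ℝ) - c * count J 0 N) / N := by
      unfold average; ring
    rw [this, abs_div, abs_of_pos hN, div_le_iff₀ hN]
    linarith
  have h1 := hD.le_affine (I := I) (J := J) (d := δ') hc
    (key.mono fun N hN => by have := (abs_le.1 hN).2; linarith)
  have h2 := hD.affine_le (I := I) (J := J) (d := -δ') hc
    (key.mono fun N hN => by have := (abs_le.1 hN).1; linarith)
  rw [abs_le]
  constructor <;> linarith

lemma shiftSet_eq (hD : IsDensity dens) (I : Set ℤ) : dens (shiftSet I) = dens I := by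
  refine eq_of_abs_sub_le_all fun ε hε => ?_
  have h := hD.abs_sub_le (I := shiftSet I) (J := I) (c := 1) (K := 1) zero_le_one hε
    (Eventually.of_forall fun N => by
      have h1 : count I 0 (N + 1) = count I 0 1 + count (shiftSet I) 0 N := by
        rw [count_shiftSet, add_comm N 1, count_add]; simp
      rw [count_succ] at h1
      have h2 := count_le I 0 1
      have h3 : ((count (shiftSet I) 0 N : ℤ) - count I 0 N) ≤ 1 := by
        split_ifs at h1 <;> omega
      have h4 : -1 ≤ ((count (shiftSet I) 0 N : ℤ) - count I 0 N) := by
        split_ifs at h1 <;> omega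
      have h3' : ((count (shiftSet I) 0 N : ℝ) - count I 0 N) ≤ 1 := by exact_mod_cast h3
      have h4' : -1 ≤ ((count (shiftSet I) 0 N : ℝ) - count I 0 N) := by exact_mod_cast h4
      rw [abs_le]
      constructor <;> linarith)
  simpa using h

lemma translate_eq (hD : IsDensity dens) (I : Set ℤ) (a : ℤ) : dens {k | a + k ∈ I} = dens I := by
  have step : ∀ a : ℤ, dens {k | a + 1 + k ∈ I} = dens {k | a + k ∈ I} := fun a => by
    rw [← hD.shiftSet_eq {k | a + k ∈ I}]
    congr 1
    ext k
    simp [shiftSet, add_comm, add_left_comm]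
  induction a using Int.induction_on with
  | zero => simp
  | succ n ih => rw [step, ih]
  | pred n ih => rw [← step, sub_add_cancel, ih]

lemma exists_count_lt_from (hD : IsDensity dens) {I J : Set ℤ} (h : dens I < dens J) (a : ℤ) :
    ∃ N, count I a N < count J a N := by
  rw [← hD.translate_eq I a, ← hD.translate_eq J a] at h
  simpa [count] using hD.exists_count_lt h

end IsDensity

/-! ### Markers -/

section Markers

variable {Λ : Type*}

/-- The positions at which the finite pattern `w` occurs in `y`. -/
def occurrences (w : Finset (ℤ × Λ)) (y : ℤ → Λ) : Set ℤ := {i | ∀ p ∈ w, y (i + p.1) = p.2}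

/-- Distinct elements of `M` have distance at least `L`. -/
def Separated (L : ℕ) (M : Set ℤ) : Prop := ∀ i ∈ M, ∀ p : ℕ, 0 < p → p < L → i + (p : ℤ) ∉ M

/-- The pattern `w` occurs in `y`, and its occurrences are `L`-separated. -/
def IsMarkerPattern (L : ℕ) (y : ℤ → Λ) (w : Finset (ℤ × Λ)) : Prop :=
  (∃ i, i ∈ occurrences w y) ∧ Separated L (occurrences w y)

/-- The occurrences of the first marker pattern in the enumeration `P`. -/
def markers (P : ℕ → Finset (ℤ × Λ)) (L : ℕ) (y : ℤ → Λ) : Set ℤ :=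
  {i | ∃ n, IsMarkerPattern L y (P n) ∧ (∀ m < n, ¬ IsMarkerPattern L y (P m)) ∧
    i ∈ occurrences (P n) y}

lemma exists_isMarkerPattern (L : ℕ) {y : ℤ → Λ} (hy : Aperiodic y) :
    ∃ w, IsMarkerPattern L y w := by
  have hdiff : ∀ p : ℕ, ∃ k : ℤ, 1 ≤ p → y (k + p) ≠ y k := fun p => by
    by_cases hp : 1 ≤ p
    · obtain ⟨k, hk⟩ := Function.ne_iff.1 (hy p hp)
      exact ⟨k, fun _ => hk⟩
    · exact ⟨0, fun h => absurd h hp⟩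
  choose k hk using hdiff
  let A : Finset ℤ := (Finset.range L).image k ∪ (Finset.range L).image fun p => k p + p
  refine ⟨A.image fun j => (j, y j), ⟨0, ?_⟩, ?_⟩
  · intro p hp
    obtain ⟨j, -, rfl⟩ := Finset.mem_image.1 hp
    simp
  · intro i hi p hp0 hpL hip
    have h1 : y (i + (k p + p)) = y (k p + p) :=
      hi (k p + p, y (k p + p)) (Finset.mem_image_of_mem (fun j => (j, y j))
        (Finset.mem_union_right _ (Finset.mem_image_of_mem (fun p : ℕ => k p + (p : ℤ))
          (Finset.mem_range.2 hpL))))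
    have h2 : y (i + p + k p) = y (k p) :=
      hip (k p, y (k p)) (Finset.mem_image_of_mem (fun j => (j, y j)) (Finset.mem_union_left _
        (Finset.mem_image_of_mem k (Finset.mem_range.2 hpL))))
    refine hk p hp0 ?_
    rw [← h1, ← h2]
    congr 1
    ring

lemma markers_nonempty_and_separated {P : ℕ → Finset (ℤ × Λ)} (hP : Function.Surjective P) (L : ℕ)
    {y : ℤ → Λ} (hy : Aperiodic y) :
    (markers P L y).Nonempty ∧ Separated L (markers P L y) := by
  have hex : ∃ n, IsMarkerPattern L y (P n) := by
    obtain ⟨w, hw⟩ := exists_isMarkerPattern L hy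
    obtain ⟨n, rfl⟩ := hP w
    exact ⟨n, hw⟩
  have heq : markers P L y = occurrences (P (Nat.find hex)) y := by
    ext i
    constructor
    · rintro ⟨n, h1, h2, h3⟩
      rwa [(Nat.find_eq_iff hex).2 ⟨h1, h2⟩]
    · exact fun h => ⟨_, Nat.find_spec hex, fun m hm => Nat.find_min hex hm, h⟩
  rw [heq]
  exact Nat.find_spec hex

lemma occurrences_shift (w : Finset (ℤ × Λ)) (y : ℤ → Λ) :
    occurrences w (shift y) = shiftSet (occurrences w y) := by
  ext i
  simp [occurrences, shift, shiftSet, add_right_comm]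

lemma isMarkerPattern_shift (L : ℕ) (y : ℤ → Λ) (w : Finset (ℤ × Λ)) :
    IsMarkerPattern L (shift y) w ↔ IsMarkerPattern L y w := by
  unfold IsMarkerPattern Separated
  rw [occurrences_shift]
  generalize occurrences w y = M
  refine and_congr ⟨fun ⟨i, hi⟩ => ⟨i + 1, hi⟩, fun ⟨i, hi⟩ => ⟨i - 1, by simpa [shiftSet]⟩⟩
    ⟨fun h i hi p hp hL => ?_, fun h i hi p hp hL => ?_⟩
  · have := h (i - 1) (by simpa [shiftSet]) p hp hL
    simpa [shiftSet, sub_add_eq_add_sub] using this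
  · have := h (i + 1) hi p hp hL
    simpa [shiftSet, add_right_comm] using this

lemma markers_shift (P : ℕ → Finset (ℤ × Λ)) (L : ℕ) (y : ℤ → Λ) :
    markers P L (shift y) = shiftSet (markers P L y) := by
  unfold markers
  simp only [isMarkerPattern_shift, occurrences_shift]
  rfl

lemma measurable_markers [MeasurableSpace Λ] [DiscreteMeasurableSpace Λ]
    (P : ℕ → Finset (ℤ × Λ)) : Measurable fun q : ℕ × (ℤ → Λ) => markers P q.1 q.2 := by
  have hocc : ∀ w i, Measurable fun q : ℕ × (ℤ → Λ) => i ∈ occurrences w q.2 := fun w i => by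
    have : (fun q : ℕ × (ℤ → Λ) => i ∈ occurrences w q.2) =
        fun q => ∀ p : w, q.2 (i + p.1.1) = p.1.2 := by
      ext q; simp [occurrences]
    rw [this]
    exact .forall fun p => ((measurable_pi_apply _).comp measurable_snd).eq_const _
  have hpat : ∀ w, Measurable fun q : ℕ × (ℤ → Λ) => IsMarkerPattern q.1 q.2 w := fun w => by
    refine (Measurable.exists fun i => hocc w i).and <| .forall fun i => .imp (hocc w i) <|
      .forall fun p => .imp measurable_const <| .imp ?_ (hocc w _).not
    exact (measurable_from_nat (f := fun L => p < L)).comp measurable_fst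
  rw [measurable_set_iff]
  exact fun i => .exists fun n => (hpat _).and <|
    (Measurable.forall fun m => .imp measurable_const (hpat _).not).and (hocc _ i)

/-- A separated set has few elements in each interval. -/
lemma Separated.count_mul_le {L : ℕ} {M : Set ℤ} (hM : Separated L M) (hL : 0 < L) (a : ℤ)
    (n : ℕ) : count M a n * L ≤ n + L := by
  have short : ∀ (a : ℤ), ∀ n ≤ L, count M a n ≤ 1 := fun a n hn => by
    unfold count
    rw [Finset.sum_boole, Nat.cast_id, Finset.card_le_one]
    simp only [Finset.mem_filter, Finset.mem_range]
    intro x hx z hz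
    rcases lt_trichotomy x z with h | h | h
    · refine absurd hz.2 ?_
      have := hM _ hx.2 (z - x) (by omega) (by omega)
      rwa [show a + (x : ℤ) + ((z - x : ℕ) : ℤ) = a + z by omega] at this
    · exact h
    · refine absurd hx.2 ?_
      have := hM _ hz.2 (x - z) (by omega) (by omega)
      rwa [show a + (z : ℤ) + ((x - z : ℕ) : ℤ) = a + x by omega] at this
  induction n using Nat.strong_induction_on generalizing a with
  | _ n ih =>
    by_cases hn : n ≤ L
    · nlinarith [short a n hn]
    · obtain ⟨m, rfl⟩ := Nat.exists_eq_add_of_le (not_le.1 hn).le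
      rw [count_add]
      have h1 := short a L le_rfl
      have h2 := ih m (by omega) (a + L)
      nlinarith

end Markers

/-! ### Thinning -/

/-- The last element of `M` that is at most `i` is `i - n`. -/
def IsLastAt (M : Set ℤ) (i : ℤ) (n : ℕ) : Prop := i - (n : ℤ) ∈ M ∧ ∀ k < n, i - (k : ℤ) ∉ M

/-- Keep a proportion `c` of `J`, by rounding the counts from the last marker in `M`; nothing is
kept to the left of all markers. -/
def thin (M J : Set ℤ) (c : ℝ) : Set ℤ :=
  {i | i ∈ J ∧ ∃ n, IsLastAt M i n ∧
    ⌊c * count J (i - n) n⌋ < ⌊c * (count J (i - n) n + 1)⌋}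

lemma thin_subset (M J : Set ℤ) (c : ℝ) : thin M J c ⊆ J := fun _ h => h.1

lemma IsLastAt.unique {M : Set ℤ} {i : ℤ} {n n' : ℕ} (h : IsLastAt M i n)
    (h' : IsLastAt M i n') : n = n' := by
  rcases lt_trichotomy n n' with hlt | heq | hlt
  · exact absurd h.1 (h'.2 n hlt)
  · exact heq
  · exact absurd h'.1 (h.2 n' hlt)

lemma exists_isLastAt {M : Set ℤ} {m i : ℤ} (hm : m ∈ M) (hmi : m ≤ i) : ∃ n, IsLastAt M i n := by
  have hex : ∃ n : ℕ, i - (n : ℤ) ∈ M :=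
    ⟨(i - m).toNat, by rwa [Int.toNat_of_nonneg (by omega), sub_sub_cancel]⟩
  exact ⟨Nat.find hex, Nat.find_spec hex, fun k hk => Nat.find_min hex hk⟩

lemma IsLastAt.zero {M : Set ℤ} {i : ℤ} (h : i ∈ M) : IsLastAt M i 0 := by
  simpa [IsLastAt] using h

lemma IsLastAt.succ {M : Set ℤ} {i : ℤ} {n : ℕ} (h : IsLastAt M i n) (hi : i + 1 ∉ M) :
    IsLastAt M (i + 1) (n + 1) := by
  refine ⟨by simpa using h.1, fun k hk => ?_⟩
  cases k with
  | zero => simpa using hi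
  | succ k => simpa using h.2 k (by omega)

/-- The rounding error is the change of the fractional part. -/
lemma IsLastAt.thin_error {M J : Set ℤ} {c : ℝ} (hc0 : 0 ≤ c) (hc1 : c ≤ 1) {i : ℤ} {n : ℕ}
    (h : IsLastAt M i n) :
    ((if i ∈ thin M J c then 1 else 0 : ℕ) : ℝ) - c * (if i ∈ J then 1 else 0 : ℕ) +
      Int.fract (c * count J (i - n) (n + 1)) = Int.fract (c * count J (i - n) n) := by
  have hmem : i ∈ thin M J c ↔
      i ∈ J ∧ ⌊c * count J (i - n) n⌋ < ⌊c * (count J (i - n) n + 1)⌋ :=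
    and_congr_right fun _ => ⟨fun ⟨n', h1, h2⟩ => by rwa [h.unique h1], fun h' => ⟨n, h, h'⟩⟩
  rw [count_succ, sub_add_cancel]
  by_cases hJ : i ∈ J
  · simp only [hJ, if_true, Nat.cast_add, Nat.cast_one, true_and] at hmem ⊢
    set r : ℝ := (count J (i - n) n : ℝ)
    have hle : ⌊c * r⌋ ≤ ⌊c * (r + 1)⌋ := Int.floor_mono (by nlinarith)
    have hle' : ⌊c * (r + 1)⌋ ≤ ⌊c * r⌋ + 1 := by
      rw [← Int.floor_add_one]
      exact Int.floor_mono (by nlinarith)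
    by_cases hlt : ⌊c * r⌋ < ⌊c * (r + 1)⌋
    · have heq : ⌊c * (r + 1)⌋ = ⌊c * r⌋ + 1 := by omega
      rw [if_pos (hmem.2 hlt), Int.fract, Int.fract, heq]
      push_cast
      ring
    · have heq : ⌊c * (r + 1)⌋ = ⌊c * r⌋ := by omega
      rw [if_neg fun h' => hlt (hmem.1 h'), Int.fract, Int.fract, heq]
      push_cast
      ring
  · have : i ∉ thin M J c := fun h' => hJ h'.1
    simp [hJ, this]

lemma count_thin {M J : Set ℤ} {c : ℝ} (hc0 : 0 ≤ c) (hc1 : c ≤ 1) (hM : M.Nonempty) :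
    ∃ K : ℝ, ∀ᶠ N : ℕ in atTop,
      |(count (thin M J c) 0 N : ℝ) - c * count J 0 N| ≤ count M 0 N + K := by
  obtain ⟨m, hm⟩ := hM
  set E : ℕ → ℝ := fun N => (count (thin M J c) 0 N : ℝ) - c * count J 0 N with hE
  have hEsucc : ∀ (N : ℕ) (n : ℕ), IsLastAt M N n →
      E (N + 1) + Int.fract (c * count J (N - n) (n + 1)) =
        E N + Int.fract (c * count J (N - n) n) := fun N n h => by
    rw [← h.thin_error hc0 hc1]
    simp only [hE, count_succ, zero_add]
    push_cast
    ring
  set N₀ : ℕ := m.toNat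
  obtain ⟨n₀, hn₀⟩ := exists_isLastAt hm (Int.self_le_toNat m)
  set K : ℝ := |E (N₀ + 1)| + 1
  have key : ∀ N ≥ N₀, ∃ n, IsLastAt M N n ∧
      |E (N + 1) + Int.fract (c * count J (N - n) (n + 1))| ≤ count M 0 (N + 1) + K := by
    intro N hN
    induction N, hN using Nat.le_induction with
    | base =>
      refine ⟨n₀, hn₀, (abs_add_le _ _).trans ?_⟩
      rw [abs_of_nonneg (Int.fract_nonneg (c * count J (N₀ - n₀) (n₀ + 1)))]
      have := Int.fract_lt_one (c * count J (N₀ - n₀) (n₀ + 1))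
      have : (0 : ℝ) ≤ count M 0 (N₀ + 1) := by positivity
      linarith
    | succ N hN ih =>
      obtain ⟨n, hn, hle⟩ := ih
      rw [count_succ M 0 (N + 1), zero_add]
      by_cases hNM : ((N + 1 : ℕ) : ℤ) ∈ M
      · refine ⟨0, .zero hNM, ?_⟩
        rw [hEsucc _ _ (.zero hNM), count_zero, if_pos hNM]
        have h1 := Int.fract_lt_one (c * count J (N - n) (n + 1))
        have h2 := Int.fract_nonneg (c * count J (N - n) (n + 1))
        rw [abs_le] at hle ⊢
        simp only [Nat.cast_zero, mul_zero, Int.fract_zero, add_zero, Nat.cast_add, Nat.cast_one]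
        constructor <;> linarith
      · have hn' : IsLastAt M ((N + 1 : ℕ) : ℤ) (n + 1) := by
          push_cast at hNM ⊢
          exact hn.succ hNM
        refine ⟨n + 1, hn', ?_⟩
        rw [hEsucc _ _ hn', if_neg hNM, add_zero]
        simpa using hle
  refine ⟨K + 1, ?_⟩
  filter_upwards [eventually_ge_atTop (N₀ + 1)] with N hN
  obtain ⟨N, rfl⟩ := Nat.exists_eq_add_of_le' (le_of_add_le_right hN)
  obtain ⟨n, -, hle⟩ := key N (by omega)
  change |E (N + 1)| ≤ _
  have h1 := Int.fract_lt_one (c * count J (N - n) (n + 1))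
  have h2 := Int.fract_nonneg (c * count J (N - n) (n + 1))
  rw [abs_le] at hle ⊢
  constructor <;> linarith

lemma thin_shiftSet (M J : Set ℤ) (c : ℝ) :
    thin (shiftSet M) (shiftSet J) c = shiftSet (thin M J c) := by
  ext i
  simp only [thin, count_shiftSet]
  simp [IsLastAt, shiftSet, sub_add_eq_add_sub]

lemma Measurable.thin {α : Type*} [MeasurableSpace α] {M J : α → Set ℤ} {c : α → ℝ}
    (hM : Measurable M) (hJ : Measurable J) (hc : Measurable c) :
    Measurable fun x => thin (M x) (J x) (c x) := by
  rw [measurable_set_iff] at hM ⊢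
  intro i
  refine (measurable_set_iff.1 hJ i).and <| .exists fun n =>
    ((hM _).and <| .forall fun k => .imp measurable_const (hM _).not).and ?_
  have hcount : Measurable fun x => (_root_.count (J x) (i - n) n : ℝ) :=
    measurable_from_nat.comp (hJ.count _ n)
  exact measurableSet_setOfPred.1 <| measurableSet_lt (hc.mul hcount).floor
    (hc.mul (hcount.add_const 1)).floor

/-! ### Matching -/

/-- After `n + 1` steps from `i`, the elements of `J` have caught up with those of `I` for the
first time. -/
def IsMatch (I J : Set ℤ) (i : ℤ) (n : ℕ) : Prop :=
  count I i (n + 1) ≤ count J i (n + 1) ∧ ∀ m < n, count J i (m + 1) < count I i (m + 1)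

/-- The parenthesis matching, with opening parentheses `I` and closing parentheses `J`. -/
noncomputable def matching (I J : Set ℤ) (i : ℤ) : Option ℤ :=
  if h : i ∈ I ∧ ∃ n, IsMatch I J i n then some (i + h.2.choose) else none

lemma IsMatch.unique {I J : Set ℤ} {i : ℤ} {n n' : ℕ} (h : IsMatch I J i n)
    (h' : IsMatch I J i n') : n = n' := by
  rcases lt_trichotomy n n' with hlt | heq | hlt
  · exact absurd h.1 (h'.2 n hlt).not_ge
  · exact heq
  · exact absurd h'.1 (h.2 n' hlt).not_ge

lemma matching_eq_some_iff {I J : Set ℤ} {i j : ℤ} :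
    matching I J i = some j ↔ i ∈ I ∧ ∃ n : ℕ, IsMatch I J i n ∧ i + n = j := by
  unfold matching
  split_ifs with h
  · rw [Option.some_inj]
    refine ⟨fun hj => ⟨h.1, _, h.2.choose_spec, hj⟩, ?_⟩
    rintro ⟨-, n, hn, rfl⟩
    rw [h.2.choose_spec.unique hn]
  · simp only [false_iff]
    rintro ⟨hi, n, hn, -⟩
    exact h ⟨hi, n, hn⟩

lemma IsMatch.mem_and_count_eq {I J : Set ℤ} {i : ℤ} {n : ℕ} (hi : i ∈ I) (h : IsMatch I J i n) :
    i + n ∈ J ∧ count I i (n + 1) = count J i (n + 1) := by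
  obtain ⟨h1, h2⟩ := h
  cases n with
  | zero =>
    simp only [count_succ, count_zero, Nat.cast_zero, add_zero, hi, if_true] at h1 ⊢
    by_cases hJ : i ∈ J <;> simp_all
  | succ n =>
    have h3 := h2 n (Nat.lt_succ_self n)
    rw [count_succ I, count_succ J] at h1 ⊢
    by_cases hJ : i + ((n + 1 : ℕ) : ℤ) ∈ J
    · rw [if_pos hJ] at h1 ⊢
      split_ifs at h1 ⊢ <;> exact ⟨hJ, by omega⟩
    · rw [if_neg hJ] at h1
      omega

lemma matching_mem {I J : Set ℤ} {i j : ℤ} (h : matching I J i = some j) : j ∈ J := by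
  obtain ⟨hi, n, hn, rfl⟩ := matching_eq_some_iff.1 h
  exact (hn.mem_and_count_eq hi).1

lemma matching_injective {I J : Set ℤ} {i i' j : ℤ} (h : matching I J i = some j)
    (h' : matching I J i' = some j) : i = i' := by
  wlog hle : i ≤ i' generalizing i i'
  · exact (this h' h (by omega)).symm
  by_contra hne
  obtain ⟨hi, n, hn, rfl⟩ := matching_eq_some_iff.1 h
  obtain ⟨hi', n', hn', heq⟩ := matching_eq_some_iff.1 h'
  obtain ⟨d, rfl⟩ : ∃ d : ℕ, i' = i + (d + 1 : ℕ) := ⟨(i' - i - 1).toNat, by omega⟩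
  obtain rfl : n = d + 1 + n' := by omega
  have h1 := (hn.mem_and_count_eq hi).2
  have h2 := (hn'.mem_and_count_eq hi').2
  have h3 := hn.2 d (by omega)
  rw [add_assoc (d + 1), count_add I, count_add J] at h1
  omega

lemma isSome_matching_iff {I J : Set ℤ} (h : ∀ i, ∃ N, count I i N < count J i N) (i : ℤ) :
    (matching I J i).isSome ↔ i ∈ I := by
  unfold matching
  split_ifs with hi
  · simp [hi.1]
  · simp only [Option.isSome_none, Bool.false_eq_true, false_iff]
    refine fun hI => hi ⟨hI, ?_⟩
    have hex : ∃ n, count I i (n + 1) ≤ count J i (n + 1) := by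
      obtain ⟨N, hN⟩ := h i
      cases N with
      | zero => simp [count_zero] at hN
      | succ n => exact ⟨n, hN.le⟩
    exact ⟨Nat.find hex, Nat.find_spec hex, fun m hm => not_le.1 (Nat.find_min hex hm)⟩

lemma matching_shiftSet (I J : Set ℤ) (i : ℤ) :
    matching (shiftSet I) (shiftSet J) i = (matching I J (i + 1)).map fun m => m - 1 := by
  ext j
  rw [matching_eq_some_iff, Option.map_eq_some_iff]
  simp only [matching_eq_some_iff, IsMatch, count_shiftSet]
  constructor
  · rintro ⟨hi, n, hn, rfl⟩
    exact ⟨i + 1 + n, ⟨hi, n, hn, rfl⟩, by ring⟩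
  · rintro ⟨_, ⟨hi, n, hn, rfl⟩, rfl⟩
    exact ⟨hi, n, hn, by ring⟩

lemma Measurable.matching {α : Type*} [MeasurableSpace α] {I J : α → Set ℤ}
    (hI : Measurable I) (hJ : Measurable J) : Measurable fun x => matching (I x) (J x) := by
  refine measurable_pi_iff.2 fun i => ?_
  have hsome : ∀ j, Measurable fun x => _root_.matching (I x) (J x) i = some j := fun j => by
    simp only [matching_eq_some_iff]
    refine (measurable_set_iff.1 hI i).and <| .exists fun n => .and (.and ?_ ?_) measurable_const
    · exact measurableSet_setOfPred.1 (measurableSet_le (hI.count i _) (hJ.count i _))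
    · exact .forall fun m => .imp measurable_const <|
        measurableSet_setOfPred.1 (measurableSet_lt (hJ.count i _) (hI.count i _))
  refine measurable_to_countable' fun o => ?_
  cases o with
  | some j => exact (hsome j).setOf
  | none =>
    have : (fun x => _root_.matching (I x) (J x) i) ⁻¹' {none} =
        {x | ¬ ∃ j, _root_.matching (I x) (J x) i = some j} := by
      ext x
      simp [Option.eq_none_iff_forall_ne_some]
    rw [this]
    exact (Measurable.exists hsome).not.setOf

/-! ### The equivariant injection -/

section Choice

variable {Λ : Type*} (P : ℕ → Finset (ℤ × Λ)) (dens : Set ℤ → ℝ)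

/-- A thinning of `J` whose density lies strictly between `dens I` and `s`. -/
noncomputable def target (y : ℤ → Λ) (I J : Set ℤ) (s : ℝ) : Set ℤ :=
  thin (markers P ⌈8 / (s - dens I)⌉₊ y) J ((dens I + s) / 2 / dens J)

variable {P dens}

lemma dens_target (hD : IsDensity dens) (hP : Function.Surjective P) {y : ℤ → Λ}
    (hy : Aperiodic y) {I J : Set ℤ} {s : ℝ} (hI : dens I < s) (hJ : s < dens J) :
    dens I < dens (target P dens y I J s) ∧ dens (target P dens y I J s) < s := by
  set L := ⌈8 / (s - dens I)⌉₊ with hLdef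
  set c := (dens I + s) / 2 / dens J with hc
  have hI0 := hD.nonneg I
  have hJ0 : 0 < dens J := by linarith
  have hc0 : 0 ≤ c := div_nonneg (by linarith) hJ0.le
  have hc1 : c ≤ 1 := by rw [hc, div_le_one hJ0]; linarith
  have hδ : 0 < s - dens I := by linarith
  have hL : 0 < L := Nat.ceil_pos.2 (by positivity)
  have hLge : 8 ≤ L * (s - dens I) := by
    rw [← div_le_iff₀ hδ]
    exact Nat.le_ceil _
  obtain ⟨hne, hsep⟩ := markers_nonempty_and_separated hP L hy
  obtain ⟨K, hK⟩ := count_thin (J := J) hc0 hc1 hne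
  have hcount : ∀ N : ℕ, (count (markers P L y) 0 N : ℝ) ≤ (s - dens I) / 8 * N + 1 := by
    intro N
    have h1 : (count (markers P L y) 0 N : ℝ) * L ≤ N + L := by
      exact_mod_cast hsep.count_mul_le hL 0 N
    have hL' : (0 : ℝ) < L := by exact_mod_cast hL
    have hN : (0 : ℝ) ≤ N := by positivity
    rw [← mul_le_mul_iff_left₀ hL']
    nlinarith
  have h := hD.abs_sub_le (I := target P dens y I J s) (J := J) (c := c)
    (δ := (s - dens I) / 8) (δ' := (s - dens I) / 4) (K := K + 1) hc0 (by linarith)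
    (hK.mono fun N hN => hN.trans (by linarith [hcount N]))
  rw [hc, div_mul_cancel₀ _ hJ0.ne', abs_le] at h
  constructor <;> linarith

lemma isEquivariantInjectionChoice_matching_target [MeasurableSpace Λ] [DiscreteMeasurableSpace Λ]
    (hD : IsDensity dens) (hP : Function.Surjective P) :
    IsEquivariantInjectionChoice dens fun y I J s => matching I (target P dens y I J s) := by
  refine ⟨?_, fun y I J s hy hI hJ => ?_⟩
  · have hdI : Measurable fun p : (ℤ → Λ) × Set ℤ × Set ℤ × ℝ => dens p.2.1 :=
      hD.measurable.comp (by fun_prop)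
    have hdJ : Measurable fun p : (ℤ → Λ) × Set ℤ × Set ℤ × ℝ => dens p.2.2.1 :=
      hD.measurable.comp (by fun_prop)
    have hL : Measurable fun p : (ℤ → Λ) × Set ℤ × Set ℤ × ℝ => ⌈8 / (p.2.2.2 - dens p.2.1)⌉₊ :=
      ((measurable_snd.snd.snd.sub hdI).const_div 8).nat_ceil
    exact Measurable.matching (by fun_prop) <|
      ((measurable_markers P).comp (hL.prodMk measurable_fst)).thin (by fun_prop)
        (((hdI.add measurable_snd.snd.snd).div_const 2).div hdJ)
  · obtain ⟨h1, h2⟩ := dens_target hD hP hy hI hJ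
    refine ⟨isSome_matching_iff fun i => hD.exists_count_lt_from h1 i,
      fun i _ j h => thin_subset _ _ _ (matching_mem h), fun i i' j => matching_injective,
      fun i => ?_, (hD.mono ?_).trans_lt h2⟩
    · dsimp only
      rw [← matching_shiftSet]
      simp only [target, hD.shiftSet_eq, markers_shift, thin_shiftSet]
    · rintro j ⟨i, -, h⟩
      exact matching_mem h

end Choice

/-- **Equivariant partial injections.** For a countable alphabet `Λ` there is a Borel,
equivariant assignment of injections `f_{(y,I,J,s)} : I → J` whenever `s̄(I) < s < s̄(J)`,
with `s̄(im f) < s`; and the same holds with the lower density `s̲` in place of `s̄`. -/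
theorem equivariant_injections {Λ : Type*} [Countable Λ]
    [MeasurableSpace Λ] [DiscreteMeasurableSpace Λ] :
    (∃ F : (ℤ → Λ) → Set ℤ → Set ℤ → ℝ → (ℤ → Option ℤ),
      IsEquivariantInjectionChoice upperDensity F) ∧
    (∃ F : (ℤ → Λ) → Set ℤ → Set ℤ → ℝ → (ℤ → Option ℤ),
      IsEquivariantInjectionChoice lowerDensity F) := by
  obtain ⟨P, hP⟩ := exists_surjective_nat (Finset (ℤ × Λ))
  exact ⟨⟨_, isEquivariantInjectionChoice_matching_target isDensity_upperDensity hP⟩,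
    ⟨_, isEquivariantInjectionChoice_matching_target isDensity_lowerDensity hP⟩⟩
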